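/- arXiv:1801.07793 — 6 statements merged into one kernel-verified Lean document; each statement's English description precedes it below -/
import Mathlib

section
/- For any two non-strict incomplete rankings a, b of n objects with n̄(a,b) ≥ 2, the normalized projected Kemeny–Snell distance and the scaled Kendall tau-extended correlation coefficient are related by the linear transformation d_{NP-KS}(a,b) = 1/2 − (1/2)·τ̂_x(a,b). -/
open Finset

/-- A non-strict incomplete ranking of `n` objects: object `i` is ranked iff `a i ≠ none`. -/
abbrev Ranking (n : ℕ) := Fin n → Option ℕ

/-- The set of objects ranked by `a`. -/
def ranked {n : ℕ} (a : Ranking n) : Finset (Fin n) :=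
  Finset.univ.filter fun i => (a i).isSome

/-- The ranking-matrix of `a`. -/
def rmat {n : ℕ} (a : Ranking n) (i j : Fin n) : ℤ :=
  if i = j then 0
  else
    match a i, a j with
    | some x, some y => if x ≤ y then 1 else -1
    | _, _ => 0

/-- `n̄(a,b)`: the number of objects ranked by both `a` and `b`. -/
def nbar {n : ℕ} (a b : Ranking n) : ℕ := (ranked a ∩ ranked b).card

/-- The scaled Kendall tau-extended correlation coefficient `τ̂ₓ(a,b)`. -/
def tauHat {n : ℕ} (a b : Ranking n) : ℚ :=
  (∑ i : Fin n, ∑ j : Fin n, ((rmat a i j * rmat b i j : ℤ) : ℚ)) /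
    ((nbar a b : ℚ) * ((nbar a b : ℚ) - 1))

/-- The Kendall tau-extended correlation coefficient `τₓ(a,b)` (extended ranking-matrix). -/
def tauX {n : ℕ} (a b : Ranking n) : ℚ :=
  (∑ i : Fin n, ∑ j : Fin n, ((rmat a i j * rmat b i j : ℤ) : ℚ)) /
    ((n : ℚ) * ((n : ℚ) - 1))

/-- The projected Kemeny–Snell distance (minimum distance unit 1/2). -/
def dPKS {n : ℕ} (a b : Ranking n) : ℚ :=
  (1/4) * ∑ i ∈ ranked a ∩ ranked b, ∑ j ∈ ranked a ∩ ranked b,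
    ((|(((a i).getD 0 : ℤ) - ((a j).getD 0 : ℤ)).sign -
       (((b i).getD 0 : ℤ) - ((b j).getD 0 : ℤ)).sign| : ℤ) : ℚ)

/-- The normalized projected Kemeny–Snell distance. -/
def dNPKS {n : ℕ} (a b : Ranking n) : ℚ :=
  if 2 ≤ nbar a b then
    dPKS a b / ((nbar a b : ℚ) * ((nbar a b : ℚ) - 1) / 2)
  else 0

/-- The projection of `a` onto the subset `S` of objects. -/
def proj {n : ℕ} (a : Ranking n) (S : Finset (Fin n)) : Ranking n :=
  fun i => if i ∈ S then a i else none

lemma rmat_eq_zero_left {n : ℕ} {a : Ranking n} {i : Fin n} (hi : i ∉ ranked a) (j : Fin n) :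
    rmat a i j = 0 := by
  have : a i = none := by simpa [ranked] using hi
  simp [rmat, this]

lemma rmat_eq_zero_right {n : ℕ} {a : Ranking n} {j : Fin n} (hj : j ∉ ranked a) (i : Fin n) :
    rmat a i j = 0 := by
  have : a j = none := by simpa [ranked] using hj
  simp [rmat, this]

/-- The ranking-matrix product only involves objects ranked by both rankings. -/
lemma sum_rmat_mul_rmat {n : ℕ} (a b : Ranking n) :
    ∑ i, ∑ j, rmat a i j * rmat b i j =
      ∑ i ∈ ranked a ∩ ranked b, ∑ j ∈ ranked a ∩ ranked b, rmat a i j * rmat b i j := by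
  rw [← Finset.sum_subset (Finset.subset_univ (ranked a ∩ ranked b))]
  · refine Finset.sum_congr rfl fun i _ => ?_
    refine (Finset.sum_subset (Finset.subset_univ _) fun j _ hj => ?_).symm
    by_cases ha : j ∈ ranked a
    · have hb : j ∉ ranked b := fun hb => hj (Finset.mem_inter.2 ⟨ha, hb⟩)
      rw [rmat_eq_zero_right hb, mul_zero]
    · rw [rmat_eq_zero_right ha, zero_mul]
  · intro i _ hi
    refine Finset.sum_eq_zero fun j _ => ?_
    by_cases ha : i ∈ ranked a
    · have hb : i ∉ ranked b := fun hb => hi (Finset.mem_inter.2 ⟨ha, hb⟩)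
      rw [rmat_eq_zero_left hb, mul_zero]
    · rw [rmat_eq_zero_left ha, zero_mul]

/-- The sign disagreement of two rankings at the pair `(i, j)`. -/
def signDist {n : ℕ} (a b : Ranking n) (i j : Fin n) : ℤ :=
  |(((a i).getD 0 : ℤ) - ((a j).getD 0 : ℤ)).sign -
    (((b i).getD 0 : ℤ) - ((b j).getD 0 : ℤ)).sign|

/-- Agreement and disagreement balance on each symmetrized pair of commonly ranked objects. -/
lemma rmat_mul_add_signDist_symm {n : ℕ} {a b : Ranking n} {i j : Fin n}
    (hi : i ∈ ranked a ∩ ranked b) (hj : j ∈ ranked a ∩ ranked b) :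
    (rmat a i j * rmat b i j + signDist a b i j) +
      (rmat a j i * rmat b j i + signDist a b j i) = if i = j then 0 else 2 := by
  simp only [ranked, Finset.mem_inter, Finset.mem_filter, Finset.mem_univ, true_and,
    Option.isSome_iff_exists] at hi hj
  obtain ⟨⟨x, hx⟩, ⟨u, hu⟩⟩ := hi
  obtain ⟨⟨y, hy⟩, ⟨v, hv⟩⟩ := hj
  by_cases hij : i = j
  · subst hij
    simp [rmat, signDist]
  · have sign_cases (x y : ℕ) :
        (x < y ∧ ((x : ℤ) - y).sign = -1 ∧ ((y : ℤ) - x).sign = 1) ∨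
        (x = y ∧ ((x : ℤ) - y).sign = 0 ∧ ((y : ℤ) - x).sign = 0) ∨
        (y < x ∧ ((x : ℤ) - y).sign = 1 ∧ ((y : ℤ) - x).sign = -1) := by
      rcases lt_trichotomy x y with h | h | h
      · exact Or.inl ⟨h, Int.sign_eq_neg_one_of_neg (by omega), Int.sign_eq_one_of_pos (by omega)⟩
      · exact Or.inr (Or.inl ⟨h, by simp [h], by simp [h]⟩)
      · exact Or.inr (Or.inr
          ⟨h, Int.sign_eq_one_of_pos (by omega), Int.sign_eq_neg_one_of_neg (by omega)⟩)
    simp only [rmat, signDist, hx, hy, hu, hv, hij, Ne.symm hij, if_false, Option.getD_some]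
    rcases sign_cases x y with ⟨h, h1, h2⟩ | ⟨h, h1, h2⟩ | ⟨h, h1, h2⟩ <;>
    rcases sign_cases u v with ⟨k, k1, k2⟩ | ⟨k, k1, k2⟩ | ⟨k, k1, k2⟩ <;>
    rw [h1, h2, k1, k2] <;>
    split_ifs <;> first | omega | norm_num

lemma sum_rmat_mul_add_sum_signDist {n : ℕ} (a b : Ranking n) :
    (∑ i, ∑ j, rmat a i j * rmat b i j) +
      ∑ i ∈ ranked a ∩ ranked b, ∑ j ∈ ranked a ∩ ranked b, signDist a b i j =
      (nbar a b : ℤ) * ((nbar a b : ℤ) - 1) := by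
  rw [sum_rmat_mul_rmat, nbar]
  set V := ranked a ∩ ranked b
  have hsum : ∑ i ∈ V, ∑ j ∈ V, ((rmat a i j * rmat b i j + signDist a b i j) +
      (rmat a j i * rmat b j i + signDist a b j i)) = 2 * ((#V : ℤ) * ((#V : ℤ) - 1)) := by
    have hrow : ∀ i ∈ V, ∑ j ∈ V, ((rmat a i j * rmat b i j + signDist a b i j) +
        (rmat a j i * rmat b j i + signDist a b j i)) = 2 * ((#V : ℤ) - 1) := by
      intro i hi
      have hite : ∀ j ∈ V, (rmat a i j * rmat b i j + signDist a b i j) +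
          (rmat a j i * rmat b j i + signDist a b j i) = 2 - if i = j then 2 else 0 := by
        intro j hj
        rw [rmat_mul_add_signDist_symm hi hj]
        split_ifs <;> rfl
      rw [Finset.sum_congr rfl hite, Finset.sum_sub_distrib, Finset.sum_ite_eq, if_pos hi,
        Finset.sum_const, nsmul_eq_mul]
      ring
    rw [Finset.sum_congr rfl hrow, Finset.sum_const, nsmul_eq_mul]
    ring
  have hswap : ∑ i ∈ V, ∑ j ∈ V, (rmat a j i * rmat b j i + signDist a b j i) =
      ∑ i ∈ V, ∑ j ∈ V, (rmat a i j * rmat b i j + signDist a b i j) := Finset.sum_comm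
  simp only [Finset.sum_add_distrib] at hsum hswap
  linarith

/-- Theorem 1: linear transformation between τ̂ₓ and d_NP-KS. -/
theorem dNPKS_eq_half_sub_half_tauHat (n : ℕ) (a b : Ranking n) (h : 2 ≤ nbar a b) :
    dNPKS a b = 1/2 - (1/2) * tauHat a b := by
  have key : (∑ i, ∑ j, ((rmat a i j * rmat b i j : ℤ) : ℚ)) +
      ∑ i ∈ ranked a ∩ ranked b, ∑ j ∈ ranked a ∩ ranked b, ((signDist a b i j : ℤ) : ℚ) =
      (nbar a b : ℚ) * ((nbar a b : ℚ) - 1) := by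
    exact_mod_cast sum_rmat_mul_add_sum_signDist a b
  have hd : dPKS a b = (1 / 4) *
      ∑ i ∈ ranked a ∩ ranked b, ∑ j ∈ ranked a ∩ ranked b, ((signDist a b i j : ℤ) : ℚ) := rfl
  have hn : (2 : ℚ) ≤ nbar a b := by exact_mod_cast h
  have hpos : (nbar a b : ℚ) * ((nbar a b : ℚ) - 1) ≠ 0 :=
    mul_ne_zero (by linarith) (by linarith)
  rw [dNPKS, if_pos h, hd, tauHat, eq_sub_of_add_eq key]
  generalize (nbar a b : ℚ) * ((nbar a b : ℚ) - 1) = N at hpos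
  field_simp
  ring
end

section
/- Let a^1, …, a^K be non-strict incomplete rankings of n objects, each ranking at least 2 objects, and let r and s be any two complete rankings of the n objects. Then Σ_{k=1}^K τ̂_x(r, a^k) ≥ Σ_{k=1}^K τ̂_x(s, a^k) if and only if Σ_{k=1}^K d_{NP-KS}(r, a^k) ≤ Σ_{k=1}^K d_{NP-KS}(s, a^k). Consequently, the ranking aggregation problems of maximizing cumulative τ̂_x correlation and of minimizing cumulative d_{NP-KS} distance over the space of complete rankings have identical optimal solution sets. -/
open Finset

/-- The sign of the difference of the positions of `i` and `j`, with unranked objects at `0`. -/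
def posSign {n : ℕ} (a : Ranking n) (i j : Fin n) : ℤ :=
  (((a i).getD 0 : ℤ) - ((a j).getD 0 : ℤ)).sign

lemma mem_ranked {n : ℕ} {a : Ranking n} {i : Fin n} : i ∈ ranked a ↔ ∃ x, a i = some x := by
  simp [ranked, Option.isSome_iff_exists]

lemma rmat_eq_zero_of_left_notMem {n : ℕ} {a : Ranking n} {i : Fin n} (h : i ∉ ranked a)
    (j : Fin n) : rmat a i j = 0 := by
  have hi : a i = none := by simpa [ranked] using h
  simp [rmat, hi]

lemma rmat_eq_zero_of_right_notMem {n : ℕ} {a : Ranking n} {j : Fin n} (h : j ∉ ranked a)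
    (i : Fin n) : rmat a i j = 0 := by
  have hj : a j = none := by simpa [ranked] using h
  cases hi : a i <;> simp [rmat, hi, hj]

/-- For two objects ranked by both rankings, the ranking-matrix products and the sign
discrepancies of the two orderings of the pair are complementary. -/
lemma rmat_mul_add_swap {n : ℕ} {a b : Ranking n} {i j : Fin n}
    (hi : i ∈ ranked a ∩ ranked b) (hj : j ∈ ranked a ∩ ranked b) :
    rmat a i j * rmat b i j + rmat a j i * rmat b j i =
      (if i = j then 0 else 2) - |posSign a i j - posSign b i j|
        - |posSign a j i - posSign b j i| := by
  by_cases hij : i = j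
  · subst hij
    simp [rmat, posSign]
  obtain ⟨hai, hbi⟩ := mem_inter.mp hi
  obtain ⟨haj, hbj⟩ := mem_inter.mp hj
  obtain ⟨x, hx⟩ := mem_ranked.mp hai
  obtain ⟨y, hy⟩ := mem_ranked.mp haj
  obtain ⟨z, hz⟩ := mem_ranked.mp hbi
  obtain ⟨w, hw⟩ := mem_ranked.mp hbj
  have sign_of_lt {p q : ℕ} (h : p < q) : ((p : ℤ) - q).sign = -1 ∧ ((q : ℤ) - p).sign = 1 :=
    ⟨Int.sign_eq_neg_one_of_neg (by omega), Int.sign_eq_one_of_pos (by omega)⟩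
  simp only [rmat, posSign, hx, hy, hz, hw, hij, Ne.symm hij, if_false, Option.getD_some]
  rcases lt_trichotomy x y with h | rfl | h <;> rcases lt_trichotomy z w with h' | rfl | h' <;>
    simp [*, le_of_lt, not_le_of_gt]

lemma sum_rmat_mul_add_sum_abs {n : ℕ} (a b : Ranking n) :
    ∑ i, ∑ j, rmat a i j * rmat b i j
      + ∑ i ∈ ranked a ∩ ranked b, ∑ j ∈ ranked a ∩ ranked b, |posSign a i j - posSign b i j|
      = (nbar a b : ℤ) * ((nbar a b : ℤ) - 1) := by
  set S := ranked a ∩ ranked b with hS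
  have hrestrict : ∑ i, ∑ j, rmat a i j * rmat b i j
      = ∑ i ∈ S, ∑ j ∈ S, rmat a i j * rmat b i j := by
    rw [← sum_product', ← sum_product', eq_comm]
    refine sum_subset (by simp) fun p _ hp => ?_
    simp only [hS, mem_product, mem_inter, not_and_or] at hp
    rcases hp with (h | h) | (h | h) <;>
      simp [rmat_eq_zero_of_left_notMem, rmat_eq_zero_of_right_notMem, h]
  have hcount : ∑ i ∈ S, ∑ j ∈ S, (if i = j then (0 : ℤ) else 2)
      = 2 * ((nbar a b : ℤ) * ((nbar a b : ℤ) - 1)) := by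
    have h : ∀ i ∈ S, ∑ j ∈ S, (if i = j then (0 : ℤ) else 2) = 2 * ((nbar a b : ℤ) - 1) := by
      intro i hi
      have hsplit : ∀ j ∈ S, (if i = j then (0 : ℤ) else 2) = 2 - if i = j then 2 else 0 := by
        intro j _
        split_ifs <;> simp
      rw [sum_congr rfl hsplit, sum_sub_distrib, sum_ite_eq, if_pos hi]
      simp [nbar, ← hS]
      ring
    rw [sum_congr rfl h]
    simp [nbar, ← hS]
    ring
  have hpairs := sum_congr rfl fun i hi => sum_congr rfl fun j hj =>
    rmat_mul_add_swap (a := a) (b := b) (i := i) (j := j) (hS ▸ hi) (hS ▸ hj)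
  simp only [sum_add_distrib, sum_sub_distrib] at hpairs
  rw [hcount, sum_comm (f := fun i j => rmat a j i * rmat b j i),
    sum_comm (f := fun i j => |posSign a j i - posSign b j i|)] at hpairs
  rw [hrestrict]
  linarith

/-- The correlation coefficient `τ̂ₓ` is an affine decreasing function of the distance. -/
lemma tauHat_eq_one_sub_two_mul_dNPKS {n : ℕ} {a b : Ranking n} (h : 2 ≤ nbar a b) :
    tauHat a b = 1 - 2 * dNPKS a b := by
  have key := congrArg (Int.cast : ℤ → ℚ) (sum_rmat_mul_add_sum_abs a b)
  have h2 : (2 : ℚ) ≤ nbar a b := by exact_mod_cast h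
  have h0 : (nbar a b : ℚ) ≠ 0 := by linarith
  have h1 : (nbar a b : ℚ) - 1 ≠ 0 := by linarith
  simp only [posSign] at key
  rw [tauHat, dNPKS, if_pos h, dPKS]
  push_cast at key ⊢
  field_simp
  linarith

lemma sum_tauHat_eq {n K : ℕ} {a : Fin K → Ranking n} (ha : ∀ k, 2 ≤ (ranked (a k)).card)
    {r : Ranking n} (hr : ranked r = univ) :
    ∑ k, tauHat r (a k) = K - 2 * ∑ k, dNPKS r (a k) := by
  have h : ∀ k, tauHat r (a k) = 1 - 2 * dNPKS r (a k) := fun k =>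
    tauHat_eq_one_sub_two_mul_dNPKS (by simpa [nbar, hr] using ha k)
  simp [h, mul_sum]

lemma sum_tauHat_le_iff {n K : ℕ} {a : Fin K → Ranking n} (ha : ∀ k, 2 ≤ (ranked (a k)).card)
    {r s : Ranking n} (hr : ranked r = univ) (hs : ranked s = univ) :
    ∑ k, tauHat s (a k) ≤ ∑ k, tauHat r (a k) ↔
      ∑ k, dNPKS r (a k) ≤ ∑ k, dNPKS s (a k) := by
  rw [sum_tauHat_eq ha hr, sum_tauHat_eq ha hs]
  constructor <;> intro h <;> linarith

/-- Corollary 1 (first part): the NIRA problems typified by τ̂ₓ and d_NP-KS are equivalent. -/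
theorem tauHat_dNPKS_aggregation_equiv (n K : ℕ) (a : Fin K → Ranking n)
    (ha : ∀ k, 2 ≤ (ranked (a k)).card)
    (r s : Ranking n) (hr : ranked r = Finset.univ) (hs : ranked s = Finset.univ) :
    ((∑ k, tauHat s (a k) ≤ ∑ k, tauHat r (a k)) ↔
      (∑ k, dNPKS r (a k) ≤ ∑ k, dNPKS s (a k))) ∧
    ({r' : Ranking n | ranked r' = Finset.univ ∧
        ∀ s' : Ranking n, ranked s' = Finset.univ →
          ∑ k, tauHat s' (a k) ≤ ∑ k, tauHat r' (a k)} =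
      {r' : Ranking n | ranked r' = Finset.univ ∧
        ∀ s' : Ranking n, ranked s' = Finset.univ →
          ∑ k, dNPKS r' (a k) ≤ ∑ k, dNPKS s' (a k)}) := by
  refine ⟨sum_tauHat_le_iff ha hr hs, Set.ext fun r' => and_congr_right fun hr' => ?_⟩
  exact forall₂_congr fun s' hs' => sum_tauHat_le_iff ha hr' hs'
end

section
/- (Relaxed triangle inequality for τ̂_x.) Let a, b, c be non-strict incomplete rankings of n objects and let W = V_a ∩ V_b ∩ V_c with |W| ≥ 2. Then τ̂_x(a|_W, b|_W) + τ̂_x(b|_W, c|_W) ≤ τ̂_x(a|_W, c|_W) + 1. -/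
open Finset

theorem exists_eq_some_of_mem_ranked {n : ℕ} {a : Ranking n} {i : Fin n} (h : i ∈ ranked a) :
    ∃ x, a i = some x := by
  simpa [ranked, Option.isSome_iff_exists] using h

theorem ranked_proj {n : ℕ} {a : Ranking n} {S : Finset (Fin n)} (h : S ⊆ ranked a) :
    ranked (proj a S) = S := by
  ext i
  rw [ranked, mem_filter]
  by_cases hi : i ∈ S
  · obtain ⟨x, hx⟩ := exists_eq_some_of_mem_ranked (h hi)
    simp [proj, hi, hx]
  · simp [proj, hi]

theorem nbar_proj {n : ℕ} {a b : Ranking n} {S : Finset (Fin n)}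
    (ha : S ⊆ ranked a) (hb : S ⊆ ranked b) : nbar (proj a S) (proj b S) = S.card := by
  rw [nbar, ranked_proj ha, ranked_proj hb, inter_self]

theorem rmat_proj_of_mem_offDiag {n : ℕ} {a : Ranking n} {S : Finset (Fin n)}
    (h : S ⊆ ranked a) {i j : Fin n} (hij : (i, j) ∈ S.offDiag) :
    rmat (proj a S) i j = 1 ∨ rmat (proj a S) i j = -1 := by
  obtain ⟨hi, hj, hne⟩ := mem_offDiag.1 hij
  obtain ⟨x, hx⟩ := exists_eq_some_of_mem_ranked (h hi)
  obtain ⟨y, hy⟩ := exists_eq_some_of_mem_ranked (h hj)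
  rcases le_or_gt x y with hxy | hxy
  · left
    simp_all [rmat, proj]
  · right
    simp_all [rmat, proj]

theorem rmat_proj_of_notMem_offDiag {n : ℕ} (a : Ranking n) {S : Finset (Fin n)}
    {i j : Fin n} (hij : (i, j) ∉ S.offDiag) : rmat (proj a S) i j = 0 := by
  by_cases hne : i = j
  · simp [rmat, hne]
  by_cases hi : i ∈ S
  · have hj : j ∉ S := fun hj => hij (mem_offDiag.2 ⟨hi, hj, hne⟩)
    simp [rmat, proj, hj]
  · simp [rmat, proj, hi]

theorem tauHat_proj {n : ℕ} {a b : Ranking n} {S : Finset (Fin n)}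
    (ha : S ⊆ ranked a) (hb : S ⊆ ranked b) :
    tauHat (proj a S) (proj b S) =
      (∑ p ∈ S.offDiag, (rmat (proj a S) p.1 p.2 * rmat (proj b S) p.1 p.2 : ℤ) : ℤ) /
        ((S.card : ℚ) * ((S.card : ℚ) - 1)) := by
  rw [tauHat, nbar_proj ha hb, ← Fintype.sum_prod_type', Int.cast_sum]
  congr 1
  refine (sum_subset (subset_univ _) fun p _ hp => ?_).symm
  rw [rmat_proj_of_notMem_offDiag a hp, zero_mul, Int.cast_zero]

/-- Axiom 5 (Relaxed triangle inequality). -/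
theorem tauHat_relaxed_triangle (n : ℕ) (a b c : Ranking n)
    (W : Finset (Fin n)) (hW : W = ranked a ∩ ranked b ∩ ranked c) (hcard : 2 ≤ W.card) :
    tauHat (proj a W) (proj b W) + tauHat (proj b W) (proj c W) ≤
      tauHat (proj a W) (proj c W) + 1 := by
  have ha : W ⊆ ranked a := by grind
  have hb : W ⊆ ranked b := by grind
  have hc : W ⊆ ranked c := by grind
  have hcard' : (2 : ℚ) ≤ W.card := by exact_mod_cast hcard
  have hpos : (0 : ℚ) < (W.card : ℚ) * ((W.card : ℚ) - 1) :=
    mul_pos (by linarith) (by linarith)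
  have hoff : (W.offDiag.card : ℚ) = (W.card : ℚ) * ((W.card : ℚ) - 1) := by
    rw [offDiag_card, Nat.cast_sub (Nat.le_mul_self _)]
    push_cast
    ring
  rw [tauHat_proj ha hb, tauHat_proj hb hc, tauHat_proj ha hc, ← add_div,
    div_add_one hpos.ne', ← hoff]
  refine div_le_div_of_nonneg_right ?_ (Nat.cast_nonneg _)
  norm_cast
  rw [card_eq_sum_ones, Nat.cast_sum, ← sum_add_distrib, ← sum_add_distrib]
  refine sum_le_sum fun p hp => ?_
  rcases rmat_proj_of_mem_offDiag ha hp with h₁ | h₁ <;>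
    rcases rmat_proj_of_mem_offDiag hb hp with h₂ | h₂ <;>
    rcases rmat_proj_of_mem_offDiag hc hp with h₃ | h₃ <;>
    simp [h₁, h₂, h₃]
end

section
/- (Scaling axiom for τ̂_x: range.) For any two non-strict incomplete rankings a, b of n objects with n̄(a,b) ≥ 2, the correlation satisfies −1 ≤ τ̂_x(a, b) ≤ 1. -/
open Finset

/-- Products of entries of two ranking-matrices are bounded by the indicator of the pairs of
distinct objects ranked by both. -/
theorem abs_rmat_mul_rmat_le {n : ℕ} (a b : Ranking n) (i j : Fin n) :
    |rmat a i j * rmat b i j| ≤ if (i, j) ∈ (ranked a ∩ ranked b).offDiag then 1 else 0 := by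
  unfold rmat
  by_cases hij : i = j
  · simp [hij]
  · cases hai : a i <;> cases haj : a j <;> cases hbi : b i <;> cases hbj : b j <;>
      simp [hij, ranked, hai, haj, hbi, hbj]
    split_ifs <;> simp

theorem abs_sum_rmat_mul_rmat_le {n : ℕ} (a b : Ranking n) :
    |∑ i : Fin n, ∑ j : Fin n, ((rmat a i j * rmat b i j : ℤ) : ℚ)| ≤
      (nbar a b : ℚ) * ((nbar a b : ℚ) - 1) := by
  set S := ranked a ∩ ranked b with hS
  have hcard : ((S.offDiag.card : ℕ) : ℚ) = (nbar a b : ℚ) * ((nbar a b : ℚ) - 1) := by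
    rw [Finset.offDiag_card, Nat.cast_sub (Nat.le_mul_self _), nbar, ← hS]
    push_cast
    ring
  rw [← hcard, ← Fintype.sum_prod_type']
  calc |∑ p : Fin n × Fin n, ((rmat a p.1 p.2 * rmat b p.1 p.2 : ℤ) : ℚ)|
      ≤ ∑ p : Fin n × Fin n, |((rmat a p.1 p.2 * rmat b p.1 p.2 : ℤ) : ℚ)| :=
        Finset.abs_sum_le_sum_abs _ _
    _ ≤ ∑ p : Fin n × Fin n, if p ∈ S.offDiag then (1 : ℚ) else 0 :=
        Finset.sum_le_sum fun p _ => by exact_mod_cast abs_rmat_mul_rmat_le a b p.1 p.2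
    _ = S.offDiag.card := by
      rw [Finset.sum_boole, Finset.filter_mem_eq_inter, Finset.univ_inter]

/-- Axiom 6 (Scaling): the correlation range is between -1 and 1, inclusively. -/
theorem tauHat_range (n : ℕ) (a b : Ranking n) (h : 2 ≤ nbar a b) :
    -1 ≤ tauHat a b ∧ tauHat a b ≤ 1 := by
  have hn : (2 : ℚ) ≤ nbar a b := by exact_mod_cast h
  have hpos : 0 < (nbar a b : ℚ) * ((nbar a b : ℚ) - 1) :=
    mul_pos (by linarith) (by linarith)
  rw [← abs_le, tauHat, abs_div, abs_of_pos hpos, div_le_one hpos]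
  exact abs_sum_rmat_mul_rmat_le a b
end

section
/- (Emond–Mason identity, re-derived in the proof of Theorem 1.) For any two complete non-strict rankings a, b of n ≥ 2 objects, the Kendall tau-extended correlation coefficient and the Kemeny–Snell distance with minimum distance unit 1/2 satisfy τ_x(a, b) = 1 − 4·d_KS(a, b)/(n(n−1)). -/
open Finset

/-- The ranking-matrix of a complete non-strict ranking `a : Fin n → ℕ`. -/
def cmat {n : ℕ} (a : Fin n → ℕ) (i j : Fin n) : ℤ :=
  if i = j then 0 else if a i ≤ a j then 1 else -1

/-- The Kendall tau-extended correlation coefficient for complete non-strict rankings. -/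
def tauXC {n : ℕ} (a b : Fin n → ℕ) : ℚ :=
  (∑ i : Fin n, ∑ j : Fin n, ((cmat a i j * cmat b i j : ℤ) : ℚ)) /
    ((n : ℚ) * ((n : ℚ) - 1))

/-- The Kemeny–Snell distance with minimum distance unit 1/2 for complete
non-strict rankings. -/
def dKSC {n : ℕ} (a b : Fin n → ℕ) : ℚ :=
  (1/4) * ∑ i : Fin n, ∑ j : Fin n,
    ((|((a i : ℤ) - (a j : ℤ)).sign - ((b i : ℤ) - (b j : ℤ)).sign| : ℤ) : ℚ)

/-- Symmetrizing over the pair `i, j`, matrix products and sign discrepancies add up to the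
number of off-diagonal entries. -/
lemma cmat_mul_add_abs_sign_symm {n : ℕ} (a b : Fin n → ℕ) (i j : Fin n) :
    (cmat a i j * cmat b i j
        + |((a i : ℤ) - (a j : ℤ)).sign - ((b i : ℤ) - (b j : ℤ)).sign|)
      + (cmat a j i * cmat b j i
        + |((a j : ℤ) - (a i : ℤ)).sign - ((b j : ℤ) - (b i : ℤ)).sign|)
      = 2 * (if i = j then 0 else 1) := by
  rcases eq_or_ne i j with rfl | hij
  · simp [cmat]
  have sign_sub_cases : ∀ x y : ℕ,
      (x < y ∧ ((x : ℤ) - y).sign = -1 ∧ ((y : ℤ) - x).sign = 1) ∨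
      (x = y ∧ ((x : ℤ) - y).sign = 0 ∧ ((y : ℤ) - x).sign = 0) ∨
      (y < x ∧ ((x : ℤ) - y).sign = 1 ∧ ((y : ℤ) - x).sign = -1) := by
    intro x y
    rcases lt_trichotomy x y with h | h | h
    · exact Or.inl ⟨h, Int.sign_eq_neg_one_of_neg (by omega), Int.sign_eq_one_of_pos (by omega)⟩
    · exact Or.inr (Or.inl ⟨h, by simp [h], by simp [h]⟩)
    · exact Or.inr (Or.inr
        ⟨h, Int.sign_eq_one_of_pos (by omega), Int.sign_eq_neg_one_of_neg (by omega)⟩)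
  rcases sign_sub_cases (a i) (a j) with ⟨ha, ha₁, ha₂⟩ | ⟨ha, ha₁, ha₂⟩ | ⟨ha, ha₁, ha₂⟩ <;>
  rcases sign_sub_cases (b i) (b j) with ⟨hb, hb₁, hb₂⟩ | ⟨hb, hb₁, hb₂⟩ | ⟨hb, hb₁, hb₂⟩ <;>
  rw [ha₁, ha₂, hb₁, hb₂] <;>
  simp [cmat, hij, hij.symm, ha, hb, ha.le, hb.le, not_le_of_gt]

/-- Matrix products and sign discrepancies sum to `n * (n - 1)`. -/
lemma sum_cmat_mul_add_sum_abs_sign {n : ℕ} (a b : Fin n → ℕ) :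
    ∑ i : Fin n, ∑ j : Fin n, cmat a i j * cmat b i j
      + ∑ i : Fin n, ∑ j : Fin n,
        |((a i : ℤ) - (a j : ℤ)).sign - ((b i : ℤ) - (b j : ℤ)).sign|
      = (n : ℤ) * ((n : ℤ) - 1) := by
  have off_diagonal : ∑ i : Fin n, ∑ j : Fin n, (if i = j then (0 : ℤ) else 1)
      = (n : ℤ) * ((n : ℤ) - 1) := by
    have h : ∀ i j : Fin n, (if i = j then (0 : ℤ) else 1) = 1 - if i = j then 1 else 0 := by
      intro i j
      split_ifs <;> rfl
    simp only [h, sum_sub_distrib, sum_ite_eq]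
    simp
    ring
  have symmetrized := sum_congr rfl fun i (_ : i ∈ (univ : Finset (Fin n))) =>
    sum_congr rfl fun j (_ : j ∈ (univ : Finset (Fin n))) => cmat_mul_add_abs_sign_symm a b i j
  simp only [sum_add_distrib, ← mul_sum, off_diagonal] at symmetrized
  rw [sum_comm (f := fun i j => cmat a j i * cmat b j i),
    sum_comm (f := fun i j =>
      |((a j : ℤ) - (a i : ℤ)).sign - ((b j : ℤ) - (b i : ℤ)).sign|)] at symmetrized
  linarith

/-- Emond–Mason identity: τₓ(a,b) = 1 − 4·d_KS(a,b)/(n(n−1)). -/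
theorem tauXC_eq_one_sub_dKSC (n : ℕ) (hn : 2 ≤ n) (a b : Fin n → ℕ) :
    tauXC a b = 1 - 4 * dKSC a b / ((n : ℚ) * ((n : ℚ) - 1)) := by
  have hn' : (2 : ℚ) ≤ n := by exact_mod_cast hn
  have hne : (n : ℚ) * ((n : ℚ) - 1) ≠ 0 := mul_ne_zero (by linarith) (by linarith)
  have total := congrArg (Int.cast : ℤ → ℚ) (sum_cmat_mul_add_sum_abs_sign a b)
  rw [tauXC, dKSC, eq_sub_iff_add_eq, ← add_div, div_eq_one_iff_eq hne]
  push_cast at total ⊢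
  linarith
end

section
/- (Mallows normalization constant.) Let n ≥ 1 and let ā be a strict complete ranking of n objects (a permutation of Fin n). Then for every real number φ, Σ over all strict complete rankings b of the n objects of φ^{d_KS(b, ā)} = Π_{k=1}^{n} (1 + φ + φ² + ⋯ + φ^{k−1}); here d_KS(b, ā) is a natural number equal to the number of unordered pairs of objects on which b and ā disagree. -/
open Finset

/-- The Kemeny–Snell (Kendall tau / inversion) distance between two strict complete
rankings (permutations): the number of unordered pairs of objects on which they
disagree. -/
def dKSPerm {n : ℕ} (a b : Equiv.Perm (Fin n)) : ℕ :=
  (Finset.univ.filter fun p : Fin n × Fin n =>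
    p.1 < p.2 ∧ ((a p.1 < a p.2 ∧ b p.2 < b p.1) ∨ (a p.2 < a p.1 ∧ b p.1 < b p.2))).card

/-- The number of inversions of a permutation of `Fin n`. -/
def inversionCount {n : ℕ} (σ : Equiv.Perm (Fin n)) : ℕ :=
  ∑ i, ∑ j, if i < j ∧ σ j < σ i then 1 else 0

/-- The permutation of `Fin (n + 1)` which sends `0` to `p` and acts on the remaining elements
in the relative order prescribed by `e`. -/
def insertZero {n : ℕ} (p : Fin (n + 1)) (e : Equiv.Perm (Fin n)) : Equiv.Perm (Fin (n + 1)) :=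
  (Equiv.Perm.decomposeFin.symm (0, e)).trans p.cycleRange.symm

lemma insertZero_zero {n : ℕ} (p : Fin (n + 1)) (e : Equiv.Perm (Fin n)) :
    insertZero p e 0 = p := by
  simp [insertZero]

lemma insertZero_succ {n : ℕ} (p : Fin (n + 1)) (e : Equiv.Perm (Fin n)) (x : Fin n) :
    insertZero p e x.succ = p.succAbove (e x) := by
  simp [insertZero]

lemma insertZero_bijective (n : ℕ) :
    Function.Bijective fun q : Fin (n + 1) × Equiv.Perm (Fin n) => insertZero q.1 q.2 := by
  rw [Fintype.bijective_iff_injective_and_card]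
  constructor
  · rintro ⟨p, e⟩ ⟨q, f⟩ h
    have hpq : p = q := by simpa [insertZero_zero] using DFunLike.congr_fun h 0
    subst hpq
    have hef : e = f := by
      ext x : 1
      simpa [insertZero_succ] using DFunLike.congr_fun h x.succ
    rw [hef]
  · simp [Fintype.card_perm, Nat.factorial_succ]

lemma sum_succAbove_lt_self {n : ℕ} (p : Fin (n + 1)) :
    ∑ x : Fin n, (if p.succAbove x < p then 1 else 0) = (p : ℕ) := by
  simp only [Fin.succAbove_lt_iff_castSucc_lt]
  simp only [Fin.lt_def, Fin.val_castSucc]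
  rw [Fin.sum_univ_eq_sum_range (fun x => if x < (p : ℕ) then 1 else 0) n, ← card_filter]
  have : (range n).filter (· < (p : ℕ)) = range p := by
    ext x
    simp only [mem_filter, mem_range]
    omega
  rw [this, card_range]

lemma inversionCount_insertZero {n : ℕ} (p : Fin (n + 1)) (e : Equiv.Perm (Fin n)) :
    inversionCount (insertZero p e) = p + inversionCount e := by
  have h := Equiv.sum_comp e fun x => if p.succAbove x < p then 1 else 0
  rw [sum_succAbove_lt_self] at h
  simp only [inversionCount, Fin.sum_univ_succ (n := n), insertZero_zero, insertZero_succ,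
    Fin.succ_lt_succ_iff, Fin.succAbove_lt_succAbove_iff, Fin.succ_pos, Fin.not_lt_zero,
    true_and, false_and, if_false, zero_add]
  rw [h]

/-- The generating function of the number of inversions is the `q`-factorial. -/
lemma sum_pow_inversionCount {R : Type*} [CommSemiring R] (q : R) (n : ℕ) :
    ∑ σ : Equiv.Perm (Fin n), q ^ inversionCount σ =
      ∏ k ∈ range n, ∑ j ∈ range (k + 1), q ^ j := by
  induction n with
  | zero => simp [inversionCount]
  | succ n ih =>
    rw [← (insertZero_bijective n).sum_comp, Fintype.sum_prod_type, prod_range_succ, ← ih,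
      mul_comm, ← Fin.sum_univ_eq_sum_range (fun j => q ^ j), sum_mul_sum]
    simp only [inversionCount_insertZero, pow_add]

lemma dKSPerm_eq_inversionCount {n : ℕ} (a b : Equiv.Perm (Fin n)) :
    dKSPerm b a = inversionCount (b * a⁻¹) := by
  have hinv : inversionCount (b * a⁻¹) =
      (univ.filter fun p : Fin n × Fin n => a p.1 < a p.2 ∧ b p.2 < b p.1).card := by
    rw [inversionCount, card_filter, Fintype.sum_prod_type, ← Equiv.sum_comp a]
    refine sum_congr rfl fun i _ => ?_
    rw [← Equiv.sum_comp a]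
    simp
  rw [hinv, dKSPerm]
  refine card_bij' (fun p _ => if a p.1 < a p.2 then p else p.swap)
    (fun p _ => if p.1 < p.2 then p else p.swap) ?_ ?_ ?_ ?_ <;>
  · rintro ⟨i, j⟩ h
    have hij : i = j → a i = a j := fun h => h ▸ rfl
    simp only [mem_filter, mem_univ, true_and] at h ⊢
    grind

/-- Mallows normalization constant:
`Σ_{b} φ^{d_KS(b, ā)} = Π_{k=1}^{n} (1 + φ + φ² + ⋯ + φ^{k-1})`. -/
theorem mallows_normalization_constant (n : ℕ) (hn : 1 ≤ n)
    (abar : Equiv.Perm (Fin n)) (φ : ℝ) :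
    ∑ b : Equiv.Perm (Fin n), φ ^ (dKSPerm b abar) =
      ∏ k ∈ Finset.range n, ∑ j ∈ Finset.range (k + 1), φ ^ j := by
  simp only [dKSPerm_eq_inversionCount]
  rw [← sum_pow_inversionCount]
  exact Equiv.sum_comp (Equiv.mulRight abar⁻¹) fun σ => φ ^ inversionCount σ
end
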